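/- Let F be a finite field with q elements, n ≥ 1, and let C be an n × n matrix over F whose characteristic polynomial is irreducible over F and whose multiplicative order is q^n − 1 (i.e. C is a Singer cycle: q^n − 1 is the least positive m with C^m = I). Then the cyclic group generated by C acts regularly on the nonzero vectors of F^n: for every nonzero row vector v ∈ F^n, the map i ↦ v·C^i is a bijection from {0, 1, …, q^n − 2} onto F^n \ {0}. -/

import Mathlib

open Polynomial in
/-- If the characteristic polynomial of `C` is irreducible, a polynomial in `C` that kills
a nonzero row vector is zero. -/
theorem Matrix.aeval_eq_zero_of_vecMul_eq_zero {F ι : Type*} [Field F] [Fintype ι] [DecidableEq ι]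
    {C : Matrix ι ι F} (hirr : Irreducible C.charpoly) {v : ι → F} (hv : v ≠ 0) {p : F[X]}
    (h : Matrix.vecMul v (aeval C p) = 0) : aeval C p = 0 := by
  rcases hirr.isCoprime_or_dvd p with hcop | ⟨r, rfl⟩
  · obtain ⟨a, b, hab⟩ := hcop
    have h1 : aeval C p * aeval C b = 1 := by
      rw [← map_mul, mul_comm p b]
      simpa only [map_add, map_mul, map_one, Matrix.aeval_self_charpoly, mul_zero, zero_add]
        using congrArg (aeval C) hab
    refine absurd ?_ hv
    rw [← Matrix.vecMul_one v, ← h1, ← Matrix.vecMul_vecMul, h, Matrix.zero_vecMul]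
  · simp [Matrix.aeval_self_charpoly]


/-- A Singer cycle acts regularly on nonzero vectors: if `C` is an `n × n`
matrix over a finite field `F` with `q` elements whose characteristic polynomial is
irreducible and whose multiplicative order is `q^n - 1`, then for every nonzero row
vector `v`, the map `i ↦ v · C^i` is a bijection from `{0, …, q^n - 2}` onto the nonzero
vectors of `F^n`. -/
theorem singer_cycle_regular {F : Type*} [Field F] [Fintype F] (n : ℕ) (hn : 1 ≤ n)
    (C : Matrix (Fin n) (Fin n) F)
    (hirr : Irreducible C.charpoly)
    (hpow : C ^ (Fintype.card F ^ n - 1) = 1)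
    (hleast : ∀ m : ℕ, 0 < m → C ^ m = 1 → Fintype.card F ^ n - 1 ≤ m) :
    ∀ v : Fin n → F, v ≠ 0 →
      Function.Injective
        (fun i : Fin (Fintype.card F ^ n - 1) => Matrix.vecMul v (C ^ (i : ℕ))) ∧
      Set.range (fun i : Fin (Fintype.card F ^ n - 1) => Matrix.vecMul v (C ^ (i : ℕ)))
        = {w : Fin n → F | w ≠ 0} := by
  intro v hv
  set N := Fintype.card F ^ n - 1 with hN
  have hlt : ∀ i j : ℕ, i < j → j < N → Matrix.vecMul v (C ^ i) ≠ Matrix.vecMul v (C ^ j) := by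
    intro i j hij hj h
    have hz := Matrix.aeval_eq_zero_of_vecMul_eq_zero hirr hv
      (p := Polynomial.X ^ j - Polynomial.X ^ i) (by simp [Matrix.vecMul_sub, h])
    have hC : C ^ j = C ^ i := by simpa [sub_eq_zero] using hz
    have h1 : C ^ (j - i) = 1 := by
      calc C ^ (j - i) = C ^ (j - i) * C ^ N := by rw [hpow, mul_one]
        _ = C ^ j * C ^ (N - i) := by rw [← pow_add, ← pow_add]; congr 1; omega
        _ = 1 := by rw [hC, ← pow_add, Nat.add_sub_cancel' (by omega), hpow]
    have := hleast (j - i) (by omega) h1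
    omega
  have hinj : Function.Injective (fun i : Fin N => Matrix.vecMul v (C ^ (i : ℕ))) := by
    intro i j h
    rcases lt_trichotomy i j with hij | hij | hij
    · exact absurd h (hlt i j hij j.2)
    · exact hij
    · exact absurd h.symm (hlt j i hij i.2)
  refine ⟨hinj, Set.eq_of_subset_of_ncard_le ?_ ?_⟩
  · rintro _ ⟨i, rfl⟩ h0
    apply hv
    have h0 : Matrix.vecMul v (C ^ (i : ℕ)) = 0 := h0
    rw [← Matrix.vecMul_one v, ← hpow, ← Nat.add_sub_cancel' i.2.le, pow_add,
      ← Matrix.vecMul_vecMul, h0, Matrix.zero_vecMul]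
  · have hset : {w : Fin n → F | w ≠ 0} = {0}ᶜ := rfl
    rw [Set.ncard_range_of_injective hinj, hset, Set.ncard_compl, Set.ncard_singleton]
    simp [hN]
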